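/- arXiv:1909.01756 — 3 statements merged into one kernel-verified Lean document; each statement's English description precedes it below -/
import Mathlib

section
/- Let K, L, i be positive integers with i·L ≤ K, and let Ŝ be the collection of i-element subsets of ZMod K in which any two distinct elements are at cyclic distance at least L; for s ∈ Ŝ let cov(s) = ⋃_{a∈s} {a − L + 1, …, a} (mod K). On the node set V = {(p, s) : p ∈ ZMod K, s ∈ Ŝ, p ∉ cov(s)}, say that (p′, s′) interferes with (p, s) if (p′, s′) ≠ (p, s) and p ∉ cov(s′), and let N⁺(v) = {v} ∪ {w ∈ V : w interferes with v}. Then |N⁺(v)| = (K − i·L) · C(K − iL + i − 1, i) for every v ∈ V. -/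
/-- `Shat K L i` is the collection of `i`-element subsets of `ZMod K` in which any two
distinct elements are at cyclic distance at least `L`. -/
def Shat (K : ℕ) [NeZero K] (L i : ℕ) : Finset (Finset (ZMod K)) :=
  Finset.univ.filter (fun s : Finset (ZMod K) =>
    s.card = i ∧ ∀ a ∈ s, ∀ b ∈ s, a ≠ b → L ≤ (a - b).val ∧ L ≤ K - (a - b).val)

/-- `W K L a = {a − L + 1, …, a}` (mod `K`), the cyclic window of length `L` ending at `a`. -/
def W (K : ℕ) [NeZero K] (L : ℕ) (a : ZMod K) : Finset (ZMod K) :=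
  (Finset.range L).image (fun j : ℕ => a - (L : ZMod K) + 1 + (j : ZMod K))

/-- `cov K L s = ⋃_{a ∈ s} W a`, the set of users that can access the subfile stored
on the caches in `s`. -/
def cov (K : ℕ) [NeZero K] (L : ℕ) (s : Finset (ZMod K)) : Finset (ZMod K) :=
  s.biUnion (W K L)

/-- The node set of the delivery-phase index coding problem at memory `M = iN/K`:
pairs `(p, s)` with `s ∈ Ŝ` and user `p` not covered by `s`. -/
def Vset (K : ℕ) [NeZero K] (L i : ℕ) : Finset (ZMod K × Finset (ZMod K)) :=
  Finset.univ.filter (fun v => v.2 ∈ Shat K L i ∧ v.1 ∉ cov K L v.2)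

/-- The closed anti-outneighborhood of a node `v`: `v` itself together with all nodes
`w ∈ V` interfering with `v` (i.e. `w ≠ v` and `v.1 ∉ cov(w.2)`). -/
def Nplus (K : ℕ) [NeZero K] (L i : ℕ) (v : ZMod K × Finset (ZMod K)) :
    Finset (ZMod K × Finset (ZMod K)) :=
  insert v ((Vset K L i).filter (fun w => w ≠ v ∧ v.1 ∉ cov K L w.2))

open Finset in
/-- The `i`-element subsets of `{0, …, n - 1}` any two elements of which differ by at least `L`. -/
def spacedSubsets (L n i : ℕ) : Finset (Finset ℕ) :=
  ((range n).powersetCard i).filter (fun s => ∀ a ∈ s, ∀ b ∈ s, a < b → a + L ≤ b)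

theorem mem_spacedSubsets {L n i : ℕ} {s : Finset ℕ} :
    s ∈ spacedSubsets L n i ↔
      (∀ a ∈ s, a < n) ∧ s.card = i ∧ ∀ a ∈ s, ∀ b ∈ s, a < b → a + L ≤ b := by
  simp [spacedSubsets, Finset.mem_powersetCard, Finset.subset_iff, and_assoc]

theorem spacedSubsets_zero_right (L n : ℕ) : spacedSubsets L n 0 = {∅} := by
  ext s
  rw [mem_spacedSubsets, Finset.mem_singleton]
  constructor
  · exact fun h => Finset.card_eq_zero.mp h.2.1
  · rintro rfl
    simp

theorem spacedSubsets_zero_succ (L i : ℕ) : spacedSubsets L 0 (i + 1) = ∅ := by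
  ext s
  simp only [mem_spacedSubsets, Finset.notMem_empty, iff_false]
  rintro ⟨h0, hc, -⟩
  obtain ⟨a, ha⟩ := Finset.card_pos.mp (by omega : 0 < s.card)
  exact absurd (h0 a ha) (Nat.not_lt_zero a)

theorem spacedSubsets_succ_succ (m n i : ℕ) :
    spacedSubsets (m + 1) (n + 1) (i + 1) =
      spacedSubsets (m + 1) n (i + 1) ∪ (spacedSubsets (m + 1) (n - m) i).image (insert n) := by
  ext s
  simp only [Finset.mem_union, Finset.mem_image, mem_spacedSubsets]
  constructor
  · rintro ⟨hlt, hc, hs⟩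
    by_cases hn : n ∈ s
    · refine Or.inr ⟨s.erase n, ⟨fun a ha => ?_, ?_, fun a ha b hb => ?_⟩, Finset.insert_erase hn⟩
      · obtain ⟨hne, ha⟩ := Finset.mem_erase.mp ha
        have h1 := hlt a ha
        have h2 := hs a ha n hn (by omega)
        omega
      · rw [Finset.card_erase_of_mem hn, hc, Nat.add_sub_cancel]
      · exact hs a (Finset.mem_of_mem_erase ha) b (Finset.mem_of_mem_erase hb)
    · refine Or.inl ⟨fun a ha => ?_, hc, hs⟩
      have h1 := hlt a ha
      have h2 : a ≠ n := fun h => hn (h ▸ ha)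
      omega
  · rintro (⟨hlt, hc, hs⟩ | ⟨t, ⟨hlt, hc, hs⟩, rfl⟩)
    · exact ⟨fun a ha => (hlt a ha).trans n.lt_succ_self, hc, hs⟩
    · have hn : n ∉ t := fun h => by have := hlt n h; omega
      refine ⟨fun a ha => ?_, by rw [Finset.card_insert_of_notMem hn, hc], fun a ha b hb hab => ?_⟩
      · rcases Finset.mem_insert.mp ha with rfl | ha
        · exact a.lt_succ_self
        · have := hlt a ha
          omega
      · rcases Finset.mem_insert.mp ha with rfl | ha' <;>
          rcases Finset.mem_insert.mp hb with rfl | hb'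
        · omega
        · have := hlt b hb'
          omega
        · have := hlt a ha'
          omega
        · exact hs a ha' b hb' hab

theorem card_spacedSubsets_succ_succ (m n i : ℕ) :
    (spacedSubsets (m + 1) (n + 1) (i + 1)).card =
      (spacedSubsets (m + 1) n (i + 1)).card + (spacedSubsets (m + 1) (n - m) i).card := by
  have hn : ∀ t ∈ spacedSubsets (m + 1) (n - m) i, n ∉ t := fun t ht h => by
    have := (mem_spacedSubsets.mp ht).1 n h
    omega
  rw [spacedSubsets_succ_succ, Finset.card_union_of_disjoint, Finset.card_image_of_injOn]
  · intro s hs t ht hst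
    rw [← Finset.erase_insert (hn s hs), ← Finset.erase_insert (hn t ht)]
    exact congrArg (fun u => Finset.erase u n) hst
  · rw [Finset.disjoint_left]
    intro s hs hs'
    obtain ⟨t, -, rfl⟩ := Finset.mem_image.mp hs'
    exact lt_irrefl n ((mem_spacedSubsets.mp hs).1 n (Finset.mem_insert_self n t))

theorem card_spacedSubsets (m n i : ℕ) :
    (spacedSubsets (m + 1) n i).card = (n + m - i * m).choose i := by
  induction n using Nat.strong_induction_on generalizing i with
  | _ n ih =>
    rcases i with _ | i
    · simp [spacedSubsets_zero_right]
    rcases n with _ | n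
    · rw [spacedSubsets_zero_succ, Finset.card_empty, Nat.choose_eq_zero_of_lt]
      rw [Nat.add_one_mul]
      omega
    rw [card_spacedSubsets_succ_succ, ih n n.lt_succ_self, ih (n - m) (by omega), Nat.add_one_mul]
    rcases Nat.lt_or_ge n (i * m) with h | h
    · have hi : 0 < i := Nat.pos_of_mul_pos_right (by omega : 0 < i * m)
      have hm : m ≤ i * m := Nat.le_mul_of_pos_left m hi
      rw [Nat.choose_eq_zero_of_lt (by omega), Nat.choose_eq_zero_of_lt (by omega),
        Nat.choose_eq_zero_of_lt (by omega)]
    · have h1 : n + 1 + m - (i * m + m) = n - i * m + 1 := by omega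
      have h2 : n + m - (i * m + m) = n - i * m := by omega
      rw [h1, h2, Nat.choose_succ_succ, add_comm]
      congr 1
      rcases i with _ | i
      · simp
      · have : m ≤ (i + 1) * m := Nat.le_mul_of_pos_left m i.succ_pos
        congr 1
        omega

section CyclicWindows

variable {K : ℕ} [NeZero K] {L i : ℕ}

theorem mem_W (hLK : L ≤ K) (a x : ZMod K) : x ∈ W K L a ↔ (a - x).val < L := by
  simp only [W, Finset.mem_image, Finset.mem_range]
  constructor
  · rintro ⟨j, hj, rfl⟩
    have h : a - (a - (L : ZMod K) + 1 + (j : ZMod K)) = ((L - 1 - j : ℕ) : ZMod K) := by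
      rw [Nat.sub_sub, Nat.cast_sub (by omega)]
      push_cast
      ring
    rw [h, ZMod.val_natCast_of_lt (by omega)]
    omega
  · intro h
    refine ⟨L - 1 - (a - x).val, by omega, ?_⟩
    rw [Nat.sub_sub, Nat.cast_sub (by omega)]
    push_cast
    rw [ZMod.natCast_zmod_val]
    ring

theorem card_W (hLK : L ≤ K) (a : ZMod K) : (W K L a).card = L := by
  rw [W, Finset.card_image_of_injOn, Finset.card_range]
  intro j hj k hk h
  have hj' : j < L := by simpa using hj
  have hk' : k < L := by simpa using hk
  have := congrArg ZMod.val (add_left_cancel h)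
  rwa [ZMod.val_natCast_of_lt (by omega), ZMod.val_natCast_of_lt (by omega)] at this

theorem val_sub_of_lt {x y : ZMod K} (h : x.val < y.val) : (x - y).val = K - (y.val - x.val) := by
  have hne : y - x ≠ 0 := fun h0 => by
    rw [sub_eq_zero.mp h0] at h
    exact lt_irrefl _ h
  have : NeZero (y - x) := ⟨hne⟩
  rw [← neg_sub, ZMod.val_neg_of_ne_zero, ZMod.val_sub h.le]

theorem disjoint_W (hLK : L ≤ K) {a b : ZMod K} (h₁ : L ≤ (a - b).val)
    (h₂ : L ≤ K - (a - b).val) : Disjoint (W K L a) (W K L b) := by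
  rw [Finset.disjoint_left]
  intro x ha hb
  rw [mem_W hLK] at ha hb
  rw [← sub_sub_sub_cancel_right a b x] at h₁ h₂
  rcases le_or_gt (b - x).val (a - x).val with h | h
  · rw [ZMod.val_sub h] at h₁
    omega
  · rw [val_sub_of_lt h] at h₂
    omega

theorem mem_Shat {s : Finset (ZMod K)} : s ∈ Shat K L i ↔
    s.card = i ∧ ∀ a ∈ s, ∀ b ∈ s, a ≠ b → L ≤ (a - b).val ∧ L ≤ K - (a - b).val := by
  simp [Shat]

theorem card_cov (hLK : L ≤ K) {s : Finset (ZMod K)} (hs : s ∈ Shat K L i) :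
    (cov K L s).card = i * L := by
  obtain ⟨hc, hs⟩ := mem_Shat.mp hs
  rw [cov, Finset.card_biUnion, Finset.sum_congr rfl fun a _ => card_W hLK a, Finset.sum_const,
    hc, smul_eq_mul]
  intro a ha b hb hab
  obtain ⟨h₁, h₂⟩ := hs a ha b hb hab
  exact disjoint_W hLK h₁ h₂

theorem notMem_cov (hLK : L ≤ K) (p : ZMod K) (s : Finset (ZMod K)) :
    p ∉ cov K L s ↔ ∀ a ∈ s, L ≤ (a - p).val := by
  simp [cov, mem_W hLK]

/-- The members of `Shat K L i` that do not cover `p` are obtained by cutting the cycle at `p`. -/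
theorem card_Shat_filter_notMem_cov (hLK : L ≤ K) (hL : 0 < L) (p : ZMod K) :
    ((Shat K L i).filter (fun s => p ∉ cov K L s)).card = (spacedSubsets L (K - L) i).card := by
  have hval : ∀ x : ℕ, x < K - L → (p + ((L + x : ℕ) : ZMod K) - p).val = L + x := fun x hx => by
    rw [add_sub_cancel_left, ZMod.val_natCast_of_lt (by omega)]
  symm
  refine Finset.card_nbij' (fun t => t.image fun x : ℕ => p + ((L + x : ℕ) : ZMod K))
    (fun s => s.image fun a => (a - p).val - L) ?_ ?_ ?_ ?_
  · intro t ht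
    obtain ⟨hlt, hc, ht⟩ := mem_spacedSubsets.mp ht
    simp only [Finset.coe_filter, Set.mem_ofPred_eq, mem_Shat, notMem_cov hLK]
    refine ⟨⟨?_, ?_⟩, ?_⟩
    · rw [Finset.card_image_of_injOn, hc]
      intro x hx y hy hxy
      have := congrArg (fun a => (a - p).val) hxy
      simp only [hval x (hlt x hx), hval y (hlt y hy)] at this
      omega
    · simp only [Finset.forall_mem_image]
      intro x hx y hy hne
      have hx' := hlt x hx
      have hy' := hlt y hy
      rw [← sub_sub_sub_cancel_right _ _ p]
      rcases lt_trichotomy x y with h | rfl | h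
      · have := ht x hx y hy h
        rw [val_sub_of_lt (by rw [hval x hx', hval y hy']; omega), hval x hx', hval y hy']
        omega
      · exact absurd rfl hne
      · have := ht y hy x hx h
        rw [ZMod.val_sub (by rw [hval x hx', hval y hy']; omega), hval x hx', hval y hy']
        omega
    · simp only [Finset.forall_mem_image]
      intro x hx
      rw [hval x (hlt x hx)]
      omega
  · intro s hs
    simp only [Finset.coe_filter, Set.mem_ofPred_eq, mem_Shat, notMem_cov hLK] at hs
    obtain ⟨⟨hc, hs⟩, hp⟩ := hs
    refine mem_spacedSubsets.mpr ⟨?_, ?_, ?_⟩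
    · simp only [Finset.forall_mem_image]
      intro a ha
      have h1 := hp a ha
      have h2 := ZMod.val_lt (a - p)
      omega
    · rw [Finset.card_image_of_injOn, hc]
      intro a ha b hb hab
      have h1 := hp a ha
      have h2 := hp b hb
      simp only at hab
      exact sub_left_injective (ZMod.val_injective K (by omega : (a - p).val = (b - p).val))
    · simp only [Finset.forall_mem_image]
      intro a ha b hb hab
      have h1 := hp a ha
      have h2 := hp b hb
      have h3 := (hs b hb a ha (by rintro rfl; exact lt_irrefl _ hab)).1
      rw [← sub_sub_sub_cancel_right b a p, ZMod.val_sub (by omega)] at h3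
      omega
  · intro t ht
    obtain ⟨hlt, -, -⟩ := mem_spacedSubsets.mp ht
    simp only [Finset.image_image]
    refine (Finset.image_congr fun x hx => ?_).trans Finset.image_id
    simp only [Function.comp_apply, hval x (hlt x hx), id]
    omega
  · intro s hs
    simp only [Finset.coe_filter, Set.mem_ofPred_eq, notMem_cov hLK] at hs
    simp only [Finset.image_image]
    refine (Finset.image_congr fun a ha => ?_).trans Finset.image_id
    simp only [Function.comp_apply, Nat.add_sub_cancel' (hs.2 a ha), ZMod.natCast_zmod_val, id]
    ring

theorem mem_Vset {v : ZMod K × Finset (ZMod K)} :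
    v ∈ Vset K L i ↔ v.2 ∈ Shat K L i ∧ v.1 ∉ cov K L v.2 := by
  simp [Vset]

theorem Nplus_eq_filter {v : ZMod K × Finset (ZMod K)} (hv : v ∈ Vset K L i) :
    Nplus K L i v = (Vset K L i).filter (fun w => v.1 ∉ cov K L w.2) := by
  ext w
  simp only [Nplus, Finset.mem_insert, Finset.mem_filter]
  constructor
  · rintro (rfl | ⟨hw, -, h⟩)
    · exact ⟨hv, (mem_Vset.mp hv).2⟩
    · exact ⟨hw, h⟩
  · rintro ⟨hw, h⟩
    exact (eq_or_ne w v).imp_right fun hne => ⟨hw, hne, h⟩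

theorem card_Vset_filter_notMem_cov (hLK : L ≤ K) (p : ZMod K) :
    ((Vset K L i).filter (fun w => p ∉ cov K L w.2)).card =
      ((Shat K L i).filter (fun s => p ∉ cov K L s)).card * (K - i * L) := by
  rw [Finset.card_eq_sum_card_fiberwise (f := Prod.snd)
    (t := (Shat K L i).filter fun s => p ∉ cov K L s), Finset.sum_const_nat]
  · intro s hs
    have hs' := Finset.mem_filter.mp hs
    have hfib : ((Vset K L i).filter (fun w => p ∉ cov K L w.2)).filter (fun w => w.2 = s) =
        (cov K L s)ᶜ ×ˢ {s} := by
      ext ⟨q, t⟩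
      simp only [Finset.mem_filter, mem_Vset, Finset.mem_product, Finset.mem_compl,
        Finset.mem_singleton]
      constructor
      · rintro ⟨⟨⟨-, h⟩, -⟩, rfl⟩
        exact ⟨h, rfl⟩
      · rintro ⟨h, rfl⟩
        exact ⟨⟨⟨hs'.1, h⟩, hs'.2⟩, rfl⟩
    rw [hfib, Finset.card_product, Finset.card_singleton, mul_one, Finset.card_compl, ZMod.card,
      card_cov hLK hs'.1]
  · intro w hw
    obtain ⟨hw, h⟩ := Finset.mem_filter.mp hw
    exact Finset.mem_filter.mpr ⟨(mem_Vset.mp hw).1, h⟩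

end CyclicWindows

/-- Every node of the ICP has a closed anti-outneighborhood of cardinality exactly
`(K − iL) · C(K − iL + i − 1, i)`. -/
theorem card_Nplus (K : ℕ) [NeZero K] (L i : ℕ)
    (hL : 0 < L) (hi : 0 < i) (hiL : i * L ≤ K)
    (v : ZMod K × Finset (ZMod K)) (hv : v ∈ Vset K L i) :
    (Nplus K L i v).card = (K - i * L) * Nat.choose (K - i * L + i - 1) i := by
  have hLK : L ≤ K := (Nat.le_mul_of_pos_left L hi).trans hiL
  rw [Nplus_eq_filter hv, card_Vset_filter_notMem_cov hLK, card_Shat_filter_notMem_cov hLK hL,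
    mul_comm]
  obtain ⟨m, rfl⟩ : ∃ m, L = m + 1 := ⟨L - 1, by omega⟩
  rw [card_spacedSubsets]
  have hmul : i * (m + 1) = i * m + i := by ring
  congr 2
  omega
end

section
/- Let K ≥ 4 be an integer and L = K − 2. On the node set V = (ZMod K) × Fin 2, with Avail(p′, q′) = {p′ + q′ + 1 + j (mod K) : j = 0, …, L−1}, a node w interferes with v = (p, q) if w ≠ v and p ∉ Avail(w). Then for every node v = (p, q), a node w interferes with v if and only if w ≠ v and w ∈ {(p, 1−q), (p+1, 0), (p−1, 1)} (indices mod K, columns zero-based); in particular, every node has exactly 3 interfering nodes. -/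
/-- For `L = K − 2`, a node `w = (p′, q′)` of the ICP (with `q′ : Fin 2` zero-based) has
`Avail K w = {p′ + q′ + 1 + j (mod K) : j = 0, …, (K−2)−1}`, the set of users at which
the subfile represented by `w` is available. -/
def Avail (K : ℕ) [NeZero K] (w : ZMod K × Fin 2) : Finset (ZMod K) :=
  (Finset.range (K - 2)).image (fun j : ℕ => w.1 + (w.2.val : ZMod K) + 1 + (j : ZMod K))

theorem mem_Avail_iff (K : ℕ) [NeZero K] (p : ZMod K) (w : ZMod K × Fin 2) :
    p ∈ Avail K w ↔ (p - (w.1 + (w.2.val : ZMod K) + 1)).val < K - 2 := by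
  simp only [Avail, Finset.mem_image, Finset.mem_range]
  constructor
  · rintro ⟨j, hj, rfl⟩
    rwa [add_sub_cancel_left, ZMod.val_natCast_of_lt (by omega)]
  · intro h
    exact ⟨_, h, by rw [ZMod.natCast_zmod_val]; ring⟩

theorem val_lt_sub_two_iff {K : ℕ} [NeZero K] (hK : 2 ≤ K) (d : ZMod K) :
    d.val < K - 2 ↔ d ≠ -1 ∧ d ≠ -2 := by
  have h1 : ((K - 1 : ℕ) : ZMod K) = -1 := by
    rw [Nat.cast_sub (by omega)]; simp
  have h2 : ((K - 2 : ℕ) : ZMod K) = -2 := by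
    rw [Nat.cast_sub hK]; simp
  have hd := ZMod.val_lt d
  constructor
  · intro h
    constructor <;> rintro rfl
    · rw [← h1, ZMod.val_natCast_of_lt (by omega)] at h
      omega
    · rw [← h2, ZMod.val_natCast_of_lt (by omega)] at h
      omega
  · rintro ⟨n1, n2⟩
    by_contra h
    obtain h | h : d.val = K - 1 ∨ d.val = K - 2 := by omega
    · exact n1 (by rw [← h1, ← h, ZMod.natCast_zmod_val])
    · exact n2 (by rw [← h2, ← h, ZMod.natCast_zmod_val])

theorem notMem_Avail_iff {K : ℕ} [NeZero K] (hK : 2 ≤ K) (p : ZMod K) (w : ZMod K × Fin 2) :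
    p ∉ Avail K w ↔ w.1 = p - (w.2.val : ZMod K) ∨ w.1 = p - (w.2.val : ZMod K) + 1 := by
  rw [mem_Avail_iff, val_lt_sub_two_iff hK, not_and_or, not_not, not_not]
  refine or_congr ?_ ?_ <;> constructor <;> intro h <;> linear_combination -h


/-- For `L = K − 2`, a node `w` interferes with `v = (p, q)` iff `w ≠ v` and
`w ∈ {(p, 1−q), (p+1, 0), (p−1, 1)}`; in particular every node has exactly 3
interfering nodes. -/
theorem interference_characterization_L_eq_K_sub_two (K : ℕ) [NeZero K] (hK : 4 ≤ K)
    (v : ZMod K × Fin 2) :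
    (∀ w : ZMod K × Fin 2,
        (w ≠ v ∧ v.1 ∉ Avail K w) ↔
          (w ≠ v ∧ (w = (v.1, 1 - v.2) ∨ w = (v.1 + 1, 0) ∨ w = (v.1 - 1, 1)))) ∧
      (Finset.univ.filter (fun w : ZMod K × Fin 2 => w ≠ v ∧ v.1 ∉ Avail K w)).card = 3 := by
  obtain ⟨p, q⟩ := v
  have char : ∀ w : ZMod K × Fin 2, (w ≠ (p, q) ∧ p ∉ Avail K w) ↔
      (w ≠ (p, q) ∧ (w = (p, 1 - q) ∨ w = (p + 1, 0) ∨ w = (p - 1, 1))) := by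
    rintro ⟨a, b⟩
    rw [notMem_Avail_iff (by omega)]
    fin_cases q <;> fin_cases b <;> simp <;> tauto
  refine ⟨char, ?_⟩
  have : Fact (1 < K) := ⟨by omega⟩
  have hset : Finset.univ.filter (fun w : ZMod K × Fin 2 => w ≠ (p, q) ∧ p ∉ Avail K w) =
      {(p, 1 - q), (p + 1, 0), (p - 1, 1)} := by
    ext w
    simp only [Finset.mem_filter, Finset.mem_univ, true_and, char, Finset.mem_insert,
      Finset.mem_singleton]
    refine ⟨And.right, fun h => ⟨?_, h⟩⟩
    rcases h with rfl | rfl | rfl <;> fin_cases q <;> simp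
  change (Finset.univ.filter (fun w : ZMod K × Fin 2 => w ≠ (p, q) ∧ p ∉ Avail K w)).card = 3
  rw [hset, Finset.card_eq_three]
  refine ⟨_, _, _, ?_, ?_, ?_, rfl⟩ <;> fin_cases q <;> simp [eq_comm (a := p)]
end

section
/- Let K ≥ 4 be an integer and L = K − 2. On the node set V = (ZMod K) × Fin 2, with Avail(p′, q′) = {p′ + q′ + 1 + j (mod K) : j = 0, …, L−1} and interference as defined, consider the coloring c : V → ZMod K given by c(p, 0) = p and c(p, 1) = p + 2. Then c is proper (c(w) ≠ c(v) whenever w interferes with v), and for every node v, the set of colors appearing on the closed anti-outneighborhood N⁺(v) = {v} ∪ {w : w interferes with v} has cardinality at most 3. -/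
/-- The coloring `c(p, 0) = p`, `c(p, 1) = p + 2` of the ICP for `L = K − 2`. -/
def col (K : ℕ) [NeZero K] (w : ZMod K × Fin 2) : ZMod K :=
  if w.2 = 0 then w.1 else w.1 + 2

theorem eq_or_add_one_eq_of_notMem_Avail {K : ℕ} [NeZero K] (hK : 2 ≤ K)
    {w : ZMod K × Fin 2} {x : ZMod K} (h : x ∉ Avail K w) :
    x = w.1 + (w.2.val : ZMod K) ∨ x + 1 = w.1 + (w.2.val : ZMod K) := by
  obtain ⟨d, hd⟩ : ∃ d, x = w.1 + (w.2.val : ZMod K) + 1 + d :=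
    ⟨x - (w.1 + (w.2.val : ZMod K) + 1), by ring⟩
  have hlt := d.val_lt
  have hcast : ((d.val : ℕ) : ZMod K) = d := ZMod.natCast_zmod_val d
  have hge : K - 2 ≤ d.val := by
    by_contra! hn
    exact h (Finset.mem_image.2 ⟨d.val, Finset.mem_range.2 hn, by rw [hcast, hd]⟩)
  have hK0 : (K : ZMod K) = 0 := ZMod.natCast_self K
  obtain h1 | h2 : d.val + 1 = K ∨ d.val + 2 = K := by omega
  · left
    have e : d + 1 = 0 := by
      have := congrArg (Nat.cast : ℕ → ZMod K) h1
      simpa [hcast, hK0] using this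
    linear_combination hd + e
  · right
    have e : d + 2 = 0 := by
      have := congrArg (Nat.cast : ℕ → ZMod K) h2
      simpa [hcast, hK0] using this
    linear_combination hd + e

theorem col_cases_of_notMem_Avail {K : ℕ} [NeZero K] (hK : 2 ≤ K)
    {w : ZMod K × Fin 2} {x : ZMod K} (h : x ∉ Avail K w) :
    (w = (x, 0) ∧ col K w = x) ∨ col K w = x + 1 ∨ (w = (x, 1) ∧ col K w = x + 2) := by
  obtain ⟨p, q⟩ := w
  have hx := eq_or_add_one_eq_of_notMem_Avail hK h
  fin_cases q
  · rcases hx with hx | hx <;> simp at hx <;> simp [col, hx]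
  · rcases hx with hx | hx <;> simp at hx
    · right; left
      simp only [col, hx]
      simp
      ring
    · simp [col, hx]

/-- For `L = K − 2`, the coloring `c(p,0) = p`, `c(p,1) = p+2` is proper (interfering
nodes get distinct colors) and at most 3 colors appear on the closed
anti-outneighborhood `N⁺(v) = {v} ∪ {w : w interferes with v}` of any node `v`. -/
theorem coloring_L_eq_K_sub_two (K : ℕ) [NeZero K] (hK : 4 ≤ K) :
    (∀ v w : ZMod K × Fin 2, (w ≠ v ∧ v.1 ∉ Avail K w) → col K w ≠ col K v) ∧
      ∀ v : ZMod K × Fin 2,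
        ((insert v (Finset.univ.filter
            (fun w : ZMod K × Fin 2 => w ≠ v ∧ v.1 ∉ Avail K w))).image (col K)).card ≤ 3 := by
  constructor
  · rintro v w ⟨hne, h⟩ heq
    have h1 : (1 : ZMod K) ≠ 0 := by
      have : Fact (1 < K) := ⟨by omega⟩
      exact one_ne_zero
    have h2 : (2 : ZMod K) ≠ 0 := by
      intro h0
      have := (ZMod.natCast_eq_zero_iff 2 K).1 (by exact_mod_cast h0)
      have := Nat.le_of_dvd (by norm_num) this
      omega
    obtain ⟨p, q⟩ := v
    have hcol : q = 0 ∧ col K (p, q) = p ∨ q = 1 ∧ col K (p, q) = p + 2 := by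
      fin_cases q <;> simp [col]
    rcases hcol with ⟨rfl, hv⟩ | ⟨rfl, hv⟩ <;>
      rcases col_cases_of_notMem_Avail (by omega) h with ⟨hw, hc⟩ | hc | ⟨hw, hc⟩ <;>
      rw [hv, hc] at heq
    · exact hne hw
    · exact h1 (by linear_combination heq)
    · exact h2 (by linear_combination heq)
    · exact h2 (by linear_combination -heq)
    · exact h1 (by linear_combination -heq)
    · exact hne hw
  · intro v
    refine (Finset.card_le_card (t := {v.1, v.1 + 1, v.1 + 2}) ?_).trans Finset.card_le_three
    intro c hc
    obtain ⟨w, hw, rfl⟩ := Finset.mem_image.1 hc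
    simp only [Finset.mem_insert, Finset.mem_singleton]
    rcases Finset.mem_insert.1 hw with rfl | hw
    · unfold col
      split_ifs <;> simp
    · rcases col_cases_of_notMem_Avail (by omega) (Finset.mem_filter.1 hw).2.2 with
        ⟨-, h⟩ | h | ⟨-, h⟩ <;> simp [h]
end
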